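/- Let ι be a nonempty finite type and T : Matrix (ι × ι) (ι × ι) ℂ a Hermitian matrix whose operator norm (as a linear operator on EuclideanSpace ℂ (ι × ι)) is at most 1, and which satisfies the Yang–Baxter equation T_1 * T_2 * T_1 = T_2 * T_1 * T_2 on (Fin 3 → ι). Then for every n ∈ ℕ, the twisted symmetrizer matrix P_{T,n} is positive semidefinite (so T is a twist); and if the operator norm of T is strictly less than 1, then every P_{T,n} is positive definite (so T is a strict twist). -/

import Mathlib

open scoped ComplexOrder
/-- The operator `T_k` acting on the `(k-1, k)` coordinates (0-indexed) of `Fin n → ι` by the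
matrix `T`, and as the identity on the remaining coordinates, for `1 ≤ k ≤ n - 1`. -/
def twistLeg {ι : Type*} [Fintype ι] [DecidableEq ι] (T : Matrix (ι × ι) (ι × ι) ℂ)
    (n k : ℕ) : Matrix (Fin n → ι) (Fin n → ι) ℂ :=
  Matrix.of fun g f =>
    if h : 1 ≤ k ∧ k < n then
      if ∀ j : Fin n, j ≠ (⟨k - 1, by omega⟩ : Fin n) → j ≠ (⟨k, h.2⟩ : Fin n) → g j = f j then
        T (g ⟨k - 1, by omega⟩, g ⟨k, h.2⟩) (f ⟨k - 1, by omega⟩, f ⟨k, h.2⟩)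
      else 0
    else 0

/-- The ampliation `E_n(P)` acting as the identity on the 0-th coordinate and as `P` on the
remaining `n` coordinates. -/
def ampMat {ι : Type*} [DecidableEq ι] (n : ℕ) (P : Matrix (Fin n → ι) (Fin n → ι) ℂ) :
    Matrix (Fin (n + 1) → ι) (Fin (n + 1) → ι) ℂ :=
  Matrix.of fun g f => if g 0 = f 0 then P (g ∘ Fin.succ) (f ∘ Fin.succ) else 0

/-- The twisted symmetrizers `P_{T,n}`, defined by the left recursion
`P_{T,n+1} = E_n(P_{T,n}) * (1 + T_1 + T_1 T_2 + ⋯ + T_1 ⋯ T_n)`. -/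
noncomputable def twistedSymmetrizer {ι : Type*} [Fintype ι] [DecidableEq ι]
    (T : Matrix (ι × ι) (ι × ι) ℂ) : (n : ℕ) → Matrix (Fin n → ι) (Fin n → ι) ℂ
  | 0 => 1
  | n + 1 =>
      ampMat n (twistedSymmetrizer T n) *
        ∑ k ∈ Finset.range (n + 1),
          ((List.range k).map (fun j => twistLeg T (n + 1) (j + 1))).prod

section BraidedSequences

variable {A : Type*} [Ring A]

/-- The product `t a * t (a + 1) * ⋯ * t (a + k - 1)`. -/
def ascProd (t : ℕ → A) (a k : ℕ) : A :=
  ((List.range k).map fun j => t (a + j)).prod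

/-- The sum of the first `m` products `ascProd t a k`. -/
def ascSum (t : ℕ → A) (a m : ℕ) : A :=
  ∑ k ∈ Finset.range m, ascProd t a k

/-- The symmetrizer on `n` sites built from the sequence `t`, starting at index `a`. -/
def seqSymmetrizer (t : ℕ → A) : ℕ → ℕ → A
  | _, 0 => 1
  | a, n + 1 => seqSymmetrizer t (a + 1) n * ascSum t a (n + 1)

@[simp] lemma ascProd_zero (t : ℕ → A) (a : ℕ) : ascProd t a 0 = 1 := by simp [ascProd]

lemma ascProd_succ (t : ℕ → A) (a k : ℕ) :
    ascProd t a (k + 1) = ascProd t a k * t (a + k) := by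
  simp [ascProd, List.range_succ]

lemma ascProd_succ' (t : ℕ → A) (a k : ℕ) :
    ascProd t a (k + 1) = t a * ascProd t (a + 1) k := by
  induction k with
  | zero => simp [ascProd_succ]
  | succ k ih =>
    rw [ascProd_succ, ih, ascProd_succ, mul_assoc, show a + (k + 1) = a + 1 + k by omega]

lemma ascSum_succ' (t : ℕ → A) (a m : ℕ) :
    ascSum t a (m + 1) = 1 + t a * ascSum t (a + 1) m := by
  rw [ascSum, Finset.sum_range_succ', ascSum, Finset.mul_sum, add_comm]
  simp [ascProd_succ']

section Commutation

variable {t : ℕ → A}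

lemma commute_ascProd (hcomm : ∀ i j, i + 2 ≤ j → Commute (t i) (t j))
    {i a : ℕ} (h : i + 2 ≤ a) (k : ℕ) : Commute (t i) (ascProd t a k) := by
  induction k with
  | zero => simp
  | succ k ih => rw [ascProd_succ]; exact ih.mul_right (hcomm _ _ (by omega))

lemma ascProd_commute (hcomm : ∀ i j, i + 2 ≤ j → Commute (t i) (t j))
    {a k i : ℕ} (h : a + k + 1 ≤ i) : Commute (ascProd t a k) (t i) := by
  induction k with
  | zero => simp
  | succ k ih => rw [ascProd_succ]; exact (ih (by omega)).mul_left (hcomm _ _ (by omega))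

lemma commute_ascSum (hcomm : ∀ i j, i + 2 ≤ j → Commute (t i) (t j))
    {i a : ℕ} (h : i + 2 ≤ a) (m : ℕ) : Commute (t i) (ascSum t a m) :=
  Commute.sum_right _ _ _ fun k _ => commute_ascProd hcomm h k

lemma commute_seqSymmetrizer (hcomm : ∀ i j, i + 2 ≤ j → Commute (t i) (t j))
    {i a : ℕ} (h : i + 2 ≤ a) (n : ℕ) :
    Commute (t i) (seqSymmetrizer t a n) := by
  induction n generalizing a with
  | zero => simp [seqSymmetrizer]
  | succ n ih => exact (ih (by omega)).mul_right (commute_ascSum hcomm h _)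

lemma ascProd_mul_shift (hcomm : ∀ i j, i + 2 ≤ j → Commute (t i) (t j))
    (hbraid : ∀ i, t i * t (i + 1) * t i = t (i + 1) * t i * t (i + 1))
    (a j d : ℕ) :
    ascProd t a (j + 2 + d) * t (a + j) = t (a + j + 1) * ascProd t a (j + 2 + d) := by
  induction d with
  | zero =>
    have h := (ascProd_commute hcomm (le_refl (a + j + 1))).eq
    have hb := hbraid (a + j)
    simp only [add_zero, ascProd_succ, ← add_assoc] at *
    rw [mul_assoc, mul_assoc, ← mul_assoc (t (a + j)), hb, ← mul_assoc, ← mul_assoc, h]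
    noncomm_ring
  | succ d ih =>
    have h := (hcomm (a + j) (a + (j + 2 + d)) (by omega)).eq
    rw [← add_assoc, ascProd_succ, mul_assoc, ← h, ← mul_assoc, ih, mul_assoc]

lemma ascProd_mul_ascProd (hcomm : ∀ i j, i + 2 ≤ j → Commute (t i) (t j))
    (hbraid : ∀ i, t i * t (i + 1) * t i = t (i + 1) * t i * t (i + 1)) (a m : ℕ) {k : ℕ}
    (hk : k < m) :
    ascProd t a m * ascProd t a k = ascProd t (a + 1) k * ascProd t a m := by
  induction k with
  | zero => simp
  | succ k ih =>
    obtain ⟨d, rfl⟩ := Nat.exists_eq_add_of_le (show k + 2 ≤ m by omega)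
    rw [ascProd_succ, ← mul_assoc, ih (by omega), mul_assoc,
      ascProd_mul_shift hcomm hbraid, ← mul_assoc, ascProd_succ]
    congr 3; omega

lemma ascSum_mul_one_sub (hcomm : ∀ i j, i + 2 ≤ j → Commute (t i) (t j))
    (hbraid : ∀ i, t i * t (i + 1) * t i = t (i + 1) * t i * t (i + 1)) (a m : ℕ) :
    ascSum t a (m + 1) * (1 - ascProd t a m) = (1 - t a * ascProd t a m) * ascSum t a m := by
  have h : ascSum t a (m + 1) * ascProd t a m =
      ascProd t a m + t a * ascProd t a m * ascSum t a m := by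
    rw [ascSum_succ', add_mul, one_mul, ascSum, ascSum, Finset.mul_sum, Finset.mul_sum,
      Finset.sum_mul]
    congr 1
    refine Finset.sum_congr rfl fun k hk => ?_
    rw [mul_assoc, mul_assoc, ascProd_mul_ascProd hcomm hbraid a m (Finset.mem_range.mp hk)]
  rw [mul_sub, h, mul_one, sub_mul, one_mul, ascSum, Finset.sum_range_succ, ← ascSum]
  abel

lemma isSelfAdjoint_seqSymmetrizer [StarRing A] (hcomm : ∀ i j, i + 2 ≤ j → Commute (t i) (t j))
    (hsa : ∀ i, IsSelfAdjoint (t i)) (a n : ℕ) :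
    IsSelfAdjoint (seqSymmetrizer t a n) := by
  induction n using Nat.twoStepInduction generalizing a with
  | zero => exact .one A
  | one => simp [seqSymmetrizer, ascSum]
  | more n ih₀ ih₁ =>
    have h₀ : star (seqSymmetrizer t (a + 2) n) = seqSymmetrizer t (a + 2) n := ih₀ _
    have h₁ : star (seqSymmetrizer t (a + 1) (n + 1)) = seqSymmetrizer t (a + 1) (n + 1) := ih₁ _
    have hrec : seqSymmetrizer t (a + 1) (n + 1) =
      seqSymmetrizer t (a + 2) n * ascSum t (a + 1) (n + 1) := rfl
    have hflip : seqSymmetrizer t (a + 1) (n + 1) =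
        star (ascSum t (a + 1) (n + 1)) * seqSymmetrizer t (a + 2) n := by
      rw [← h₁, hrec, star_mul, h₀]
    have hc := (commute_seqSymmetrizer hcomm (le_refl (a + 2)) n).eq
    have hleft : seqSymmetrizer t a (n + 2) =
        star (ascSum t a (n + 2)) * seqSymmetrizer t (a + 1) (n + 1) := by
      change seqSymmetrizer t (a + 1) (n + 1) * ascSum t a (n + 2) = _
      rw [ascSum_succ', mul_add, mul_one, star_add, star_one, star_mul, (hsa a).star_eq, add_mul,
        one_mul]
      congr 1
      rw [hflip, mul_assoc, ← mul_assoc _ (t a), ← hc, ← hflip, hrec]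
      simp only [mul_assoc]
    rw [IsSelfAdjoint]
    nth_rw 1 [seqSymmetrizer]
    rw [star_mul, h₁, hleft]

end Commutation

lemma seqSymmetrizer_shift (t : ℕ → A) (a n : ℕ) :
    seqSymmetrizer (fun k => t (k + 1)) a n = seqSymmetrizer t (a + 1) n := by
  induction n generalizing a with
  | zero => rfl
  | succ n ih =>
    simp only [seqSymmetrizer, ih, ascSum, ascProd, add_right_comm]

lemma map_seqSymmetrizer {B : Type*} [Ring B] (φ : A →+* B) (t : ℕ → A) (a n : ℕ) :
    φ (seqSymmetrizer t a n) = seqSymmetrizer (fun k => φ (t k)) a n := by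
  induction n generalizing a with
  | zero => simp [seqSymmetrizer]
  | succ n ih =>
    simp [seqSymmetrizer, ih, ascSum, ascProd, map_list_prod, Function.comp_def]

lemma seqSymmetrizer_zero (a n : ℕ) : seqSymmetrizer (0 : ℕ → A) a n = 1 := by
  induction n generalizing a with
  | zero => rfl
  | succ n ih =>
    rw [seqSymmetrizer, ih, one_mul, ascSum_succ']
    simp

lemma continuous_seqSymmetrizer [TopologicalSpace A] [IsTopologicalRing A]
    {X : Type*} [TopologicalSpace X] {t : X → ℕ → A} (ht : ∀ k, Continuous fun x => t x k)
    (a n : ℕ) : Continuous fun x => seqSymmetrizer (t x) a n := by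
  induction n generalizing a with
  | zero => exact continuous_const
  | succ n ih =>
    refine (ih _).mul (continuous_finsetSum _ fun k _ => ?_)
    exact continuous_list_prod _ fun j _ => ht _

end BraidedSequences

section Normed

variable {A : Type*} [NormedRing A] {t : ℕ → A}

lemma norm_ascProd_lt_one (hnorm : ∀ i, ‖t i‖ < 1) (a k : ℕ) : ‖ascProd t a (k + 1)‖ < 1 := by
  induction k with
  | zero => simpa [ascProd_succ] using hnorm a
  | succ k ih =>
    rw [ascProd_succ]
    exact (norm_mul_le _ _).trans_lt
      (mul_lt_one_of_nonneg_of_lt_one_left (norm_nonneg _) ih (hnorm _).le)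

variable [CompleteSpace A]

lemma isUnit_ascSum (hcomm : ∀ i j, i + 2 ≤ j → Commute (t i) (t j))
    (hbraid : ∀ i, t i * t (i + 1) * t i = t (i + 1) * t i * t (i + 1))
    (hnorm : ∀ i, ‖t i‖ < 1) (a m : ℕ) : IsUnit (ascSum t a (m + 1)) := by
  induction m with
  | zero => simp [ascSum]
  | succ m ih =>
    have h₁ : IsUnit (1 - ascProd t a (m + 1)) :=
      isUnit_one_sub_of_norm_lt_one (norm_ascProd_lt_one hnorm a m)
    have h₂ : IsUnit (1 - t a * ascProd t a (m + 1)) :=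
      isUnit_one_sub_of_norm_lt_one ((norm_mul_le _ _).trans_lt
        (mul_lt_one_of_nonneg_of_lt_one_left (norm_nonneg _) (hnorm a)
          (norm_ascProd_lt_one hnorm a m).le))
    have h := ascSum_mul_one_sub hcomm hbraid a (m + 1)
    exact h₁.unit.isUnit_mul_units _ |>.mp (by simpa [h] using h₂.mul ih)

lemma isUnit_seqSymmetrizer (hcomm : ∀ i j, i + 2 ≤ j → Commute (t i) (t j))
    (hbraid : ∀ i, t i * t (i + 1) * t i = t (i + 1) * t i * t (i + 1))
    (hnorm : ∀ i, ‖t i‖ < 1) (a n : ℕ) : IsUnit (seqSymmetrizer t a n) := by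
  induction n generalizing a with
  | zero => exact isUnit_one
  | succ n ih => exact (ih _).mul (isUnit_ascSum hcomm hbraid hnorm a n)

end Normed

section Matrices

open scoped Matrix Matrix.Norms.L2Operator

variable {m : Type*} [Fintype m] [DecidableEq m]

/-- Positive definiteness propagates along a continuous path of invertible Hermitian matrices. -/
lemma Matrix.posDef_of_path {X : Type*} [TopologicalSpace X] [PreconnectedSpace X]
    {F : X → Matrix m m ℂ} (hF : Continuous F) (hherm : ∀ x, (F x).IsHermitian)
    (hunit : ∀ x, IsUnit (F x)) {x₀ : X} (h₀ : (F x₀).PosDef) (x : X) : (F x).PosDef := by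
  have hclosed : IsClosed {x | (F x).PosDef} := by
    have : {x | (F x).PosDef} = ⋂ v : m → ℂ, {x | 0 ≤ star v ⬝ᵥ (F x *ᵥ v)} := by
      ext x
      simp only [Set.mem_ofPred_eq, Set.mem_iInter]
      refine ⟨fun h v => h.posSemidef.dotProduct_mulVec_nonneg v, fun h => ?_⟩
      exact ((Matrix.PosSemidef.of_dotProduct_mulVec_nonneg (hherm x) h).posDef_iff_isUnit).mpr
        (hunit x)
    rw [this]
    refine isClosed_iInter fun v => isClosed_le continuous_const ?_
    fun_prop
  have hopen : IsOpen {x | (F x).PosDef} := by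
    rw [isOpen_iff_mem_nhds]
    intro x hx
    have key : ∀ᶠ y in nhds x, ∀ v ∈ Metric.sphere (0 : m → ℂ) 1,
        0 < (star v ⬝ᵥ (F y *ᵥ v)).re := by
      refine (isCompact_sphere _ _).eventually_forall_of_forall_eventually fun v hv => ?_
      have hcont : Continuous fun p : X × (m → ℂ) => (star p.2 ⬝ᵥ (F p.1 *ᵥ p.2)).re := by
        fun_prop
      refine hcont.continuousAt.eventually (lt_mem_nhds ?_)
      have hv0 : v ≠ 0 := by rintro rfl; simp at hv
      exact hx.re_dotProduct_pos hv0
    filter_upwards [key] with y hy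
    refine Matrix.PosDef.of_dotProduct_mulVec_pos (hherm y) fun v hv => ?_
    have hn : 0 < ‖v‖ := norm_pos_iff.mpr hv
    have h := hy ((‖v‖⁻¹ : ℝ) • v) (by simp [norm_smul, hn.ne'])
    have him := (hherm y).im_star_dotProduct_mulVec_self v
    rw [Complex.pos_iff]
    refine ⟨?_, him.symm⟩
    simp only [star_smul, Matrix.mulVec_smul, smul_dotProduct, dotProduct_smul, Complex.smul_re,
      star_trivial] at h
    have hi : 0 < ‖v‖⁻¹ := inv_pos.mpr hn
    exact (pos_of_smul_pos_left (pos_of_smul_pos_left h hi.le) hi.le)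
  exact Set.eq_univ_iff_forall.mp (IsClopen.eq_univ ⟨hclosed, hopen⟩ ⟨x₀, h₀⟩) x

lemma posDef_seqSymmetrizer {t : ℕ → Matrix m m ℂ}
    (hcomm : ∀ i j, i + 2 ≤ j → Commute (t i) (t j))
    (hbraid : ∀ i, t i * t (i + 1) * t i = t (i + 1) * t i * t (i + 1))
    (hsa : ∀ i, IsSelfAdjoint (t i)) (hnorm : ∀ i, ‖t i‖ < 1) (a n : ℕ) :
    (seqSymmetrizer t a n).PosDef := by
  let s : unitInterval → ℕ → Matrix m m ℂ := fun x k => ((x : ℝ) : ℂ) • t k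
  have hcomm' : ∀ x i j, i + 2 ≤ j → Commute (s x i) (s x j) := fun x i j h =>
    ((hcomm i j h).smul_left _).smul_right _
  have hpos := Matrix.posDef_of_path (F := fun x => seqSymmetrizer (s x) a n) (x₀ := 0)
    (continuous_seqSymmetrizer (fun k => by fun_prop) a n)
    (fun x => isSelfAdjoint_seqSymmetrizer (hcomm' x)
      (fun i => IsSelfAdjoint.smul (by simp [IsSelfAdjoint]) (hsa i)) a n)
    (fun x => isUnit_seqSymmetrizer (hcomm' x) (fun i => by simp [s, hbraid i])
      (fun i => by
        rw [norm_smul, Complex.norm_real, Real.norm_of_nonneg x.2.1]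
        exact mul_lt_one_of_nonneg_of_lt_one_right x.2.2 (norm_nonneg _) (hnorm i)) a n)
    (by
      have : s 0 = 0 := by ext1 k; simp [s]
      simpa only [this, seqSymmetrizer_zero] using Matrix.PosDef.one) 1
  simpa [s] using hpos

lemma posSemidef_seqSymmetrizer {t : ℕ → Matrix m m ℂ}
    (hcomm : ∀ i j, i + 2 ≤ j → Commute (t i) (t j))
    (hbraid : ∀ i, t i * t (i + 1) * t i = t (i + 1) * t i * t (i + 1))
    (hsa : ∀ i, IsSelfAdjoint (t i)) (hnorm : ∀ i, ‖t i‖ ≤ 1) (a n : ℕ) :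
    (seqSymmetrizer t a n).PosSemidef := by
  let s : ℝ → ℕ → Matrix m m ℂ := fun x k => (x : ℂ) • t k
  refine .of_dotProduct_mulVec_nonneg (isSelfAdjoint_seqSymmetrizer hcomm hsa a n) fun v => ?_
  have hcont : Continuous fun x => star v ⬝ᵥ (seqSymmetrizer (s x) a n *ᵥ v) := by
    have := continuous_seqSymmetrizer (t := s) (fun k => by fun_prop) a n
    fun_prop
  have hpos : ∀ x ∈ Set.Ico (0 : ℝ) 1, 0 ≤ star v ⬝ᵥ (seqSymmetrizer (s x) a n *ᵥ v) := by
    intro x hx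
    refine (posDef_seqSymmetrizer
      (fun i j h => ((hcomm i j h).smul_left _).smul_right _) (fun i => by simp [hbraid i])
      (fun i => IsSelfAdjoint.smul (by simp [IsSelfAdjoint]) (hsa i))
      (fun i => ?_) a n).posSemidef.dotProduct_mulVec_nonneg v
    rw [norm_smul, Complex.norm_real, Real.norm_of_nonneg hx.1]
    exact mul_lt_one_of_nonneg_of_lt_one_left hx.1 hx.2 (hnorm i)
  have hmem : (1 : ℝ) ∈ closure (Set.Ico (0 : ℝ) 1) := by
    rw [closure_Ico zero_ne_one]; simp
  have := (isClosed_le continuous_const hcont).closure_subset_iff.mpr hpos hmem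
  simpa [s] using this

end Matrices

section Ampliation

variable {ι α β γ : Type*}

open scoped Classical in
/-- The ampliation of an operator on the sites `α` to the sites `β` along `u : α → β`, acting as
the identity on the sites outside the range of `u`. -/
noncomputable def embMat (u : α → β) (M : Matrix (α → ι) (α → ι) ℂ) :
    Matrix (β → ι) (β → ι) ℂ :=
  Matrix.of fun g f => if ∀ j ∉ Set.range u, g j = f j then M (g ∘ u) (f ∘ u) else 0

lemma embMat_mul [Fintype ι] [Fintype α] [DecidableEq α] [Fintype β] [DecidableEq β]
    {u : α → β} (hu : u.Injective) (M N : Matrix (α → ι) (α → ι) ℂ) :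
    embMat u (M * N) = embMat u M * embMat u N := by
  classical
  ext g f
  simp only [embMat, Matrix.mul_apply, Matrix.of_apply]
  split_ifs with h
  · refine Fintype.sum_of_injective (fun k => Function.extend u k f)
      (fun k l hkl => by simpa [Function.extend_comp hu] using congrArg (· ∘ u) hkl) _ _ ?_ ?_
    · intro i hi
      rw [if_neg (c := ∀ j ∉ Set.range u, i j = f j), mul_zero]
      refine fun hif => hi ⟨i ∘ u, ?_⟩
      ext j
      by_cases hj : j ∈ Set.range u
      · obtain ⟨j, rfl⟩ := hj
        simp [hu.extend_apply]
      · simp only [Function.extend_apply' _ _ _ hj, hif j hj]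
    · intro k
      have hk : ∀ j ∉ Set.range u, Function.extend u k f j = f j := fun j hj =>
        Function.extend_apply' _ _ _ hj
      rw [if_pos hk, if_pos fun j hj => (h j hj).trans (hk j hj).symm,
        Function.extend_comp hu]
  · refine (Finset.sum_eq_zero fun i _ => ?_).symm
    by_cases h₁ : ∀ j ∉ Set.range u, g j = i j
    · rw [if_neg (c := ∀ j ∉ Set.range u, i j = f j), mul_zero]
      exact fun h₂ => h fun j hj => (h₁ j hj).trans (h₂ j hj)
    · rw [if_neg h₁, zero_mul]

lemma embMat_one [DecidableEq ι] [Fintype α] [Fintype β] (u : α → β) : embMat u (1 : Matrix (α → ι) (α → ι) ℂ) = 1 := by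
  ext g f
  simp only [embMat, Matrix.of_apply, Matrix.one_apply]
  split_ifs with h₁ h₂ h₃ h₃ h₂
  · rfl
  · refine absurd (funext fun j => ?_) h₃
    by_cases hj : j ∈ Set.range u
    · obtain ⟨j, rfl⟩ := hj
      exact congrFun h₂ j
    · exact h₁ j hj
  · subst h₃; exact absurd rfl h₂
  · rfl
  · subst h₂; exact absurd (fun _ _ => rfl) h₁
  · rfl

lemma embMat_add (u : α → β) (M N : Matrix (α → ι) (α → ι) ℂ) :
    embMat u (M + N) = embMat u M + embMat u N := by
  ext g f
  simp only [embMat, Matrix.of_apply, Matrix.add_apply]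
  split_ifs <;> simp

lemma embMat_zero (u : α → β) : embMat u (0 : Matrix (α → ι) (α → ι) ℂ) = 0 := by
  ext g f
  simp [embMat]

lemma embMat_smul (u : α → β) (c : ℂ) (M : Matrix (α → ι) (α → ι) ℂ) :
    embMat u (c • M) = c • embMat u M := by
  ext g f
  simp [embMat]

lemma embMat_star (u : α → β) (M : Matrix (α → ι) (α → ι) ℂ) :
    embMat u (star M) = star (embMat u M) := by
  ext g f
  simp only [embMat, Matrix.star_apply, Matrix.of_apply]
  by_cases h : ∀ j ∉ Set.range u, g j = f j
  · rw [if_pos h, if_pos fun j hj => (h j hj).symm]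
  · rw [if_neg h, if_neg fun h' => h fun j hj => (h' j hj).symm, star_zero]

/-- `embMat u` as a star algebra homomorphism. -/
noncomputable def embHom [Fintype ι] [DecidableEq ι] [Fintype α] [DecidableEq α] [Fintype β]
    [DecidableEq β] (u : α → β) (hu : u.Injective) :
    Matrix (α → ι) (α → ι) ℂ →⋆ₐ[ℂ] Matrix (β → ι) (β → ι) ℂ where
  toFun := embMat u
  map_one' := embMat_one u
  map_mul' := embMat_mul hu
  map_zero' := embMat_zero u
  map_add' := embMat_add u
  commutes' c := by simp [Algebra.algebraMap_eq_smul_one, embMat_smul, embMat_one]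
  map_star' := embMat_star u

lemma embMat_embMat (v : β → γ) (hv : v.Injective) (u : α → β) (M : Matrix (α → ι) (α → ι) ℂ) :
    embMat v (embMat u M) = embMat (v ∘ u) M := by
  ext g f
  simp only [embMat, Matrix.of_apply, Function.comp_assoc, ← ite_and]
  congr 1
  refine propext ⟨fun ⟨h₁, h₂⟩ j hj => ?_, fun h => ⟨fun j hj => h j ?_, fun j hj => h (v j) ?_⟩⟩
  · by_cases hjv : j ∈ Set.range v
    · obtain ⟨j, rfl⟩ := hjv
      exact h₂ j fun ⟨i, hi⟩ => hj ⟨i, congrArg v hi⟩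
    · exact h₁ j hjv
  · rintro ⟨i, rfl⟩
    exact hj ⟨u i, rfl⟩
  · rintro ⟨i, hi⟩
    exact hj ⟨i, hv hi⟩

lemma embMat_mul_embMat_apply [Fintype ι] [Fintype β] [DecidableEq β]
    {u : α → β} {v : γ → β}
    (huv : ∀ a c, u a ≠ v c) (M : Matrix (α → ι) (α → ι) ℂ) (N : Matrix (γ → ι) (γ → ι) ℂ)
    (g f : β → ι) [Decidable (∀ j, j ∉ Set.range u → j ∉ Set.range v → g j = f j)] :
    (embMat u M * embMat v N) g f =
      if ∀ j, j ∉ Set.range u → j ∉ Set.range v → g j = f j then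
        M (g ∘ u) (f ∘ u) * N (g ∘ v) (f ∘ v) else 0 := by
  classical
  have hru : ∀ a, u a ∉ Set.range v := fun a ⟨c, hc⟩ => huv a c hc.symm
  have hrv : ∀ c, v c ∉ Set.range u := fun c ⟨a, ha⟩ => huv a c ha
  simp only [embMat, Matrix.mul_apply, Matrix.of_apply]
  let h : β → ι := fun j => if j ∈ Set.range u then f j else g j
  have hhu : h ∘ u = f ∘ u := by ext a; simp [h]
  have hhv : h ∘ v = g ∘ v := by ext c; exact if_neg (hrv c)
  have hgh : ∀ j ∉ Set.range u, g j = h j := fun j hj => (if_neg hj).symm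
  rw [Finset.sum_eq_single h, if_pos hgh, hhu, hhv, mul_ite, mul_zero]
  · congr 1
    refine propext ⟨fun H j hj₁ hj₂ => (hgh j hj₁).trans (H j hj₂), fun H j hj => ?_⟩
    by_cases hju : j ∈ Set.range u
    · exact if_pos hju
    · exact (hgh j hju).symm.trans (H j hju hj)
  · intro k _ hk
    by_cases h₁ : ∀ j ∉ Set.range u, g j = k j
    · rw [if_neg (c := ∀ j ∉ Set.range v, k j = f j), mul_zero]
      refine fun h₂ => hk (funext fun j => ?_)
      by_cases hju : j ∈ Set.range u
      · obtain ⟨a, rfl⟩ := hju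
        rw [h₂ _ (hru a)]
        exact (congrFun hhu a).symm
      · rw [← hgh j hju, h₁ j hju]
    · rw [if_neg h₁, zero_mul]
  · simp

lemma commute_embMat [Fintype ι] [Fintype β] [DecidableEq β] {u : α → β} {v : γ → β}
    (huv : ∀ a c, u a ≠ v c) (M : Matrix (α → ι) (α → ι) ℂ) (N : Matrix (γ → ι) (γ → ι) ℂ) :
    Commute (embMat u M) (embMat v N) := by
  classical
  ext g f
  rw [embMat_mul_embMat_apply huv, embMat_mul_embMat_apply fun c a => (huv a c).symm, mul_comm]
  congr 1
  exact propext ⟨fun h j h₁ h₂ => h j h₂ h₁, fun h j h₁ h₂ => h j h₂ h₁⟩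

end Ampliation

section TwistLeg

open scoped Matrix.Norms.L2Operator

variable {ι : Type*} [DecidableEq ι]

lemma ampMat_eq_embMat (n : ℕ) (P : Matrix (Fin n → ι) (Fin n → ι) ℂ) :
    ampMat n P = embMat Fin.succ P := by
  ext g f
  simp only [ampMat, embMat, Matrix.of_apply]
  congr 1
  simp [Fin.range_succ]

variable [Fintype ι]

/-- Matrices on pairs, viewed as matrices on two sites. -/
def pairMat (T : Matrix (ι × ι) (ι × ι) ℂ) : Matrix (Fin 2 → ι) (Fin 2 → ι) ℂ :=
  T.submatrix (finTwoArrowEquiv ι) (finTwoArrowEquiv ι)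

/-- `pairMat` as a star algebra homomorphism. -/
def pairHom : Matrix (ι × ι) (ι × ι) ℂ →⋆ₐ[ℂ] Matrix (Fin 2 → ι) (Fin 2 → ι) ℂ where
  toFun := pairMat
  map_one' := Matrix.submatrix_one_equiv _
  map_mul' M N := (Matrix.submatrix_mul_equiv M N _ _ _).symm
  map_zero' := rfl
  map_add' _ _ := rfl
  commutes' c := by
    simp only [Algebra.algebraMap_eq_smul_one, pairMat, Matrix.submatrix_smul, Pi.smul_apply,
      Matrix.submatrix_one_equiv]
  map_star' _ := rfl

/-- The inclusion of two sites at positions `j` and `j + 1`. -/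
def legIncl (n j : ℕ) (h : j + 1 < n) : Fin 2 → Fin n :=
  ![⟨j, by omega⟩, ⟨j + 1, h⟩]

lemma legIncl_injective (n j : ℕ) (h : j + 1 < n) : (legIncl n j h).Injective := by
  intro a b
  fin_cases a <;> fin_cases b <;> simp [legIncl]

lemma twistLeg_eq_embMat (T : Matrix (ι × ι) (ι × ι) ℂ) (n j : ℕ) (h : j + 1 < n) :
    twistLeg T n (j + 1) = embMat (legIncl n j h) (pairMat T) := by
  ext g f
  simp only [twistLeg, embMat, Matrix.of_apply, pairMat, Matrix.submatrix_apply]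
  rw [dif_pos ⟨by omega, h⟩]
  congr 1
  simp only [legIncl, Matrix.range_cons, Matrix.range_empty, Set.union_empty, Set.mem_union,
    Set.mem_singleton_iff, not_or, and_imp]
  rfl

lemma twistLeg_eq_zero (T : Matrix (ι × ι) (ι × ι) ℂ) (n j : ℕ) (h : n ≤ j + 1) :
    twistLeg T n (j + 1) = 0 := by
  ext g f
  simp only [twistLeg, Matrix.of_apply, Matrix.zero_apply]
  exact dif_neg (by omega)

lemma commute_twistLeg (T : Matrix (ι × ι) (ι × ι) ℂ) (n : ℕ) {i j : ℕ} (h : i + 2 ≤ j) :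
    Commute (twistLeg T n (i + 1)) (twistLeg T n (j + 1)) := by
  by_cases hj : j + 1 < n
  · rw [twistLeg_eq_embMat T n i (by omega), twistLeg_eq_embMat T n j hj]
    refine commute_embMat (fun a c => ?_) _ _
    fin_cases a <;> fin_cases c <;> simp [legIncl] <;> omega
  · rw [twistLeg_eq_zero T n j (by omega)]
    exact Commute.zero_right _

lemma isSelfAdjoint_twistLeg {T : Matrix (ι × ι) (ι × ι) ℂ} (hT : T.IsHermitian) (n j : ℕ) :
    IsSelfAdjoint (twistLeg T n (j + 1)) := by
  by_cases hj : j + 1 < n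
  · rw [twistLeg_eq_embMat T n j hj]
    have hpair : IsSelfAdjoint (pairMat T) := congrArg pairMat hT
    rw [IsSelfAdjoint, ← embMat_star, hpair.star_eq]
  · rw [twistLeg_eq_zero T n j (by omega)]
    exact .zero _

lemma norm_twistLeg_le (T : Matrix (ι × ι) (ι × ι) ℂ) (n j : ℕ) :
    ‖twistLeg T n (j + 1)‖ ≤ ‖T‖ := by
  by_cases hj : j + 1 < n
  · rw [twistLeg_eq_embMat T n j hj]
    exact (NonUnitalStarAlgHom.norm_apply_le
      (embHom (ι := ι) _ (legIncl_injective n j hj)) (pairMat T)).trans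
      (NonUnitalStarAlgHom.norm_apply_le pairHom T)
  · rw [twistLeg_eq_zero T n j (by omega), norm_zero]
    exact norm_nonneg _

lemma embMat_twistLeg (T : Matrix (ι × ι) (ι × ι) ℂ) {m n : ℕ} (u : Fin m → Fin n)
    (hu : u.Injective) (i j : ℕ) (hi : i + 1 < m) (hj : j + 1 < n)
    (h₀ : u ⟨i, by omega⟩ = ⟨j, by omega⟩) (h₁ : u ⟨i + 1, hi⟩ = ⟨j + 1, hj⟩) :
    embMat u (twistLeg T m (i + 1)) = twistLeg T n (j + 1) := by
  rw [twistLeg_eq_embMat T m i hi, twistLeg_eq_embMat T n j hj, embMat_embMat u hu]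
  congr 1
  ext1 a
  fin_cases a
  · exact h₀
  · exact h₁

lemma twistLeg_braid {T : Matrix (ι × ι) (ι × ι) ℂ}
    (hYBE : twistLeg T 3 1 * twistLeg T 3 2 * twistLeg T 3 1 =
      twistLeg T 3 2 * twistLeg T 3 1 * twistLeg T 3 2) (n i : ℕ) :
    twistLeg T n (i + 1) * twistLeg T n (i + 1 + 1) * twistLeg T n (i + 1) =
      twistLeg T n (i + 1 + 1) * twistLeg T n (i + 1) * twistLeg T n (i + 1 + 1) := by
  by_cases hi : i + 2 < n
  · let u : Fin 3 → Fin n := fun a => ⟨i + a, by omega⟩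
    have hu : u.Injective := fun a b h => by simpa [u, Fin.ext_iff] using h
    rw [← embMat_twistLeg T u hu 0 i (by omega) (by omega) rfl rfl,
      ← embMat_twistLeg T u hu 1 (i + 1) (by omega) (by omega) rfl rfl]
    simp only [← embMat_mul hu]
    exact congrArg (embMat u) hYBE
  · rw [twistLeg_eq_zero T n (i + 1) (by omega)]
    simp

lemma embMat_succ_twistLeg (T : Matrix (ι × ι) (ι × ι) ℂ) (n j : ℕ) :
    embMat Fin.succ (twistLeg T n (j + 1)) = twistLeg T (n + 1) (j + 1 + 1) := by
  by_cases hj : j + 1 < n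
  · exact embMat_twistLeg T _ (Fin.succ_injective n) j (j + 1) hj (by omega) rfl rfl
  · rw [twistLeg_eq_zero T n j (by omega), twistLeg_eq_zero T (n + 1) (j + 1) (by omega),
      embMat_zero]

lemma twistedSymmetrizer_eq (T : Matrix (ι × ι) (ι × ι) ℂ) (n : ℕ) :
    twistedSymmetrizer T n = seqSymmetrizer (fun j => twistLeg T n (j + 1)) 0 n := by
  induction n with
  | zero => rfl
  | succ n ih =>
    have h : embMat Fin.succ (seqSymmetrizer (fun j => twistLeg T n (j + 1)) 0 n) =
        seqSymmetrizer (fun j => embMat Fin.succ (twistLeg T n (j + 1))) 0 n :=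
      map_seqSymmetrizer (embHom (ι := ι) _ (Fin.succ_injective n)).toAlgHom.toRingHom _ 0 n
    simp only [embMat_succ_twistLeg] at h
    rw [twistedSymmetrizer, ampMat_eq_embMat, ih, h,
      seqSymmetrizer_shift (fun j => twistLeg T (n + 1) (j + 1))]
    simp [seqSymmetrizer, ascSum, ascProd]

end TwistLeg

/-- a Hermitian `T` with operator norm at most `1` satisfying the Yang–Baxter
equation is a twist (all `P_{T,n}` are positive semidefinite), and if moreover `‖T‖ < 1` then
`T` is a strict twist (all `P_{T,n}` are positive definite). -/
theorem twistedSymmetrizer_posSemidef_of_yangBaxter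
    {ι : Type*} [Fintype ι] [DecidableEq ι] [Nonempty ι]
    (T : Matrix (ι × ι) (ι × ι) ℂ) (hT : T.IsHermitian)
    (hnorm : ‖Matrix.toEuclideanCLM (𝕜 := ℂ) T‖ ≤ 1)
    (hYBE : twistLeg T 3 1 * twistLeg T 3 2 * twistLeg T 3 1 =
      twistLeg T 3 2 * twistLeg T 3 1 * twistLeg T 3 2) :
    (∀ n : ℕ, (twistedSymmetrizer T n).PosSemidef) ∧
      (‖Matrix.toEuclideanCLM (𝕜 := ℂ) T‖ < 1 →
        ∀ n : ℕ, (twistedSymmetrizer T n).PosDef) := by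
  have hcomm n i j (h : i + 2 ≤ j) := commute_twistLeg T n h
  have hbraid := twistLeg_braid hYBE
  have hsa := isSelfAdjoint_twistLeg hT
  refine ⟨fun n => ?_, fun hlt n => ?_⟩ <;> rw [twistedSymmetrizer_eq]
  · exact posSemidef_seqSymmetrizer (hcomm n) (hbraid n) (hsa n)
      (fun i => (norm_twistLeg_le T n i).trans hnorm) 0 n
  · exact posDef_seqSymmetrizer (hcomm n) (hbraid n) (hsa n)
      (fun i => (norm_twistLeg_le T n i).trans_lt hlt) 0 n
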